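/- arXiv:1906.00237 — 2 statements merged into one kernel-verified Lean document; each statement's English description precedes it below -/
import Mathlib

section
/- Define on [0,3]: ū(t) = π² + 1 for t ∈ [0, log 2), ū(t) = π² for t ∈ [log 2, 2), ū(t) = π² − 1/(4 − t) for t ∈ [2, 3]; ȳ₁(t) = e^t for t ∈ [0, log 2], ȳ₁(t) = 2 for t ∈ [log 2, 2], ȳ₁(t) = 4 − t for t ∈ [2, 3]; and ŷ_d(t) = 1.5 e^t for t ∈ (0, log 2), ŷ_d(t) = 3 for t ∈ (log 2, 1), ŷ_d(t) = 4 − t for t ∈ (1, 3). Let u : [0,3] → ℝ be measurable with −1 ≤ u(t) ≤ π² + 1 a.e., and let y₁ : [0,3] → ℝ be absolutely continuous with y₁(0) = 1, y₁′(t) + π² y₁(t) = u(t) y₁(t) a.e., and y₁(t) ≤ 2 for all t ∈ [0,3]. Then |y₁(t) − ŷ_d(t)| ≥ |ȳ₁(t) − ŷ_d(t)| for almost every t ∈ (0,3), and consequently ½ ∫₀³ (y₁(t) − ŷ_d(t))² dt + ½ (y₁(3) − 1)² ≥ ½ ∫₀³ (ȳ₁(t) − ŷ_d(t))² dt + ½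 (ȳ₁(3) − 1)². -/
open MeasureTheory Set Real intervalIntegral

/-- An absolutely continuous function with a.e. nonpositive derivative does not increase. -/
theorem AbsolutelyContinuousOnInterval.le_of_ae_deriv_nonpos {f : ℝ → ℝ} {a b : ℝ} (hab : a ≤ b)
    (hf : AbsolutelyContinuousOnInterval f a b) (hf' : ∀ᵐ t, t ∈ Ioo a b → deriv f t ≤ 0) :
    f b ≤ f a := by
  have hintegral : ∫ t in a..b, deriv f t ≤ 0 := by
    rw [integral_of_le hab, integral_Ioc_eq_integral_Ioo]
    exact integral_nonpos_of_ae ((ae_restrict_iff' measurableSet_Ioo).2 hf')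
  rw [hf.integral_deriv_eq_sub] at hintegral
  linarith

/-- A Grönwall inequality for absolutely continuous functions. -/
theorem AbsolutelyContinuousOnInterval.abs_le_mul_exp {y : ℝ → ℝ} {a b K : ℝ} (hab : a ≤ b)
    (hy : AbsolutelyContinuousOnInterval y a b)
    (hy' : ∀ᵐ t, t ∈ Ioo a b → y t * deriv y t ≤ K * y t ^ 2) :
    |y b| ≤ |y a| * exp (K * (b - a)) := by
  let v : ℝ → ℝ := fun t => exp (-K * t) * y t
  have hexp : AbsolutelyContinuousOnInterval (fun t : ℝ => exp (-K * t)) a b :=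
    ContDiffOn.absolutelyContinuousOnInterval (ContDiff.contDiffOn (by fun_prop))
  have hv : AbsolutelyContinuousOnInterval v a b := hexp.fun_mul hy
  have hle : v b * v b ≤ v a * v a := by
    refine (hv.fun_mul hv).le_of_ae_deriv_nonpos hab ?_
    filter_upwards [hy.ae_differentiableAt, hy'] with t hdiff ht htab
    have hdy := (hdiff (Ioo_subset_Icc_self.trans Icc_subset_uIcc htab)).hasDerivAt
    have hdv : HasDerivAt v (exp (-K * t) * (deriv y t - K * y t)) t := by
      have hde : HasDerivAt (fun t : ℝ => exp (-K * t)) (exp (-K * t) * (-K * 1)) t :=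
        ((hasDerivAt_id t).const_mul (-K)).exp
      exact (hde.mul hdy).congr_deriv (by ring)
    rw [(hdv.fun_mul hdv).deriv]
    have := mul_nonneg (sq_nonneg (exp (-K * t))) (sub_nonneg.2 (ht htab))
    simp only [v]
    linarith
  have habs : |v b| ≤ |v a| := sq_le_sq.1 (by simpa only [sq] using hle)
  simp only [v, abs_mul, abs_exp] at habs
  calc |y b| = exp (K * b) * (exp (-K * b) * |y b|) := by
        rw [← mul_assoc, ← exp_add]; simp
    _ ≤ exp (K * b) * (exp (-K * a) * |y a|) := by gcongr
    _ = |y a| * exp (K * (b - a)) := by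
        rw [← mul_assoc, ← exp_add, mul_comm]; ring_nf

/-- Optimality of the trajectory (B.5)-(B.6) in the example of the paper's appendix: any
admissible trajectory `(u, y₁)` of the reduced problem satisfies
`|y₁(t) − ŷ_d(t)| ≥ |ȳ₁(t) − ŷ_d(t)|` a.e., hence its reduced cost is at least that of
`(ū, ȳ₁)`. -/
theorem stmt_9 (ubar ybar yd : ℝ → ℝ)
    (hub : ∀ t : ℝ, ubar t =
      if t < Real.log 2 then π ^ 2 + 1 else if t < 2 then π ^ 2 else π ^ 2 - 1 / (4 - t))
    (hyb : ∀ t : ℝ, ybar t =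
      if t ≤ Real.log 2 then Real.exp t else if t ≤ 2 then 2 else 4 - t)
    (hyd : ∀ t : ℝ, yd t =
      if t ≤ Real.log 2 then 1.5 * Real.exp t else if t ≤ 1 then 3 else 4 - t)
    (u : ℝ → ℝ) (hu_meas : AEMeasurable u (volume.restrict (Ioo 0 3)))
    (hu_bd : ∀ᵐ t ∂(volume.restrict (Ioo 0 3)), -1 ≤ u t ∧ u t ≤ π ^ 2 + 1)
    (y₁ y₁' : ℝ → ℝ) (hy0 : y₁ 0 = 1)
    (hy'_int : IntegrableOn y₁' (Icc 0 3))
    (hAC : ∀ t ∈ Icc (0 : ℝ) 3, y₁ t = y₁ 0 + ∫ s in (0 : ℝ)..t, y₁' s)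
    (hODE : ∀ᵐ t ∂(volume.restrict (Ioo 0 3)), y₁' t + π ^ 2 * y₁ t = u t * y₁ t)
    (hconstr : ∀ t ∈ Icc (0 : ℝ) 3, y₁ t ≤ 2) :
    (∀ᵐ t ∂(volume.restrict (Ioo 0 3)), |ybar t - yd t| ≤ |y₁ t - yd t|) ∧
      (1 / 2) * (∫ t in (0 : ℝ)..3, (ybar t - yd t) ^ 2) + (1 / 2) * (ybar 3 - 1) ^ 2 ≤
        (1 / 2) * (∫ t in (0 : ℝ)..3, (y₁ t - yd t) ^ 2) + (1 / 2) * (y₁ 3 - 1) ^ 2 := by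
  have hlog1 : Real.log 2 ≤ 1 := by have := Real.log_two_lt_d9; linarith
  have hexplog : exp (Real.log 2) = 2 := exp_log two_pos
  have hii : IntervalIntegrable y₁' volume 0 3 :=
    (intervalIntegrable_iff_integrableOn_Icc_of_le (by norm_num)).2 hy'_int
  let Y : ℝ → ℝ := fun t => 1 + ∫ s in (0 : ℝ)..t, y₁' s
  have hYy : ∀ t ∈ Icc (0 : ℝ) 3, y₁ t = Y t := fun t ht => by rw [hAC t ht, hy0]
  have hY : AbsolutelyContinuousOnInterval Y 0 3 :=
    (ContDiffOn.absolutelyContinuousOnInterval contDiffOn_const).fun_add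
      (hii.absolutelyContinuousOnInterval_intervalIntegral (by simp))
  have hY' : ∀ᵐ t, t ∈ Ioo (0 : ℝ) 3 → Y t * deriv Y t ≤ 1 * Y t ^ 2 := by
    filter_upwards [hii.ae_hasDerivAt_integral, (ae_restrict_iff' measurableSet_Ioo).1 hu_bd,
      (ae_restrict_iff' measurableSet_Ioo).1 hODE] with t hderiv hbd hode ht
    have hd : HasDerivAt Y (y₁' t) t :=
      (hderiv (Ioo_subset_Icc_self.trans Icc_subset_uIcc ht) 0 (by simp)).const_add 1
    have hode' := hode ht
    rw [hYy t (Ioo_subset_Icc_self ht)] at hode'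
    rw [hd.deriv, show y₁' t = (u t - π ^ 2) * Y t by linarith]
    nlinarith [mul_nonneg (sub_nonneg.2 (hbd ht).2) (sq_nonneg (Y t))]
  have hgrowth : ∀ t ∈ Icc (0 : ℝ) 3, y₁ t ≤ exp t := by
    intro t ht
    have hsub : uIcc 0 t ⊆ uIcc (0 : ℝ) 3 := by
      rw [uIcc_of_le ht.1, uIcc_of_le (by norm_num)]
      exact Icc_subset_Icc_right ht.2
    have h := (hY.mono hsub).abs_le_mul_exp ht.1
      (hY'.mono fun s hs hst => hs ⟨hst.1, hst.2.trans_le ht.2⟩)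
    have hY0 : Y 0 = 1 := by simp [Y]
    rw [hY0, ← hYy t ht] at h
    simpa using (le_abs_self _).trans h
  have hpt : ∀ t ∈ Icc (0 : ℝ) 3, |ybar t - yd t| ≤ |y₁ t - yd t| := by
    intro t ht
    have hexp := hgrowth t ht
    have htwo := hconstr t ht
    have hpos := exp_pos t
    by_cases ht2 : t ≤ 2
    · have hle : y₁ t ≤ ybar t ∧ ybar t ≤ yd t := by
        rw [hyb, hyd]
        split_ifs <;> constructor <;> linarith
      rw [abs_of_nonpos (by linarith), abs_of_nonpos (by linarith)]
      linarith
    · rw [hyb, hyd, if_neg (by linarith), if_neg ht2, if_neg (by linarith), if_neg (by linarith)]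
      simp
  have hyd_cont : Continuous yd := by
    rw [funext hyd]
    refine Continuous.if_le (by fun_prop) (Continuous.if_le (by fun_prop) (by fun_prop)
      (by fun_prop) (by fun_prop) ?_) (by fun_prop) (by fun_prop) ?_
    · rintro t rfl
      norm_num
    · rintro t rfl
      rw [if_pos hlog1, hexplog]
      norm_num
  have hy_cont : ContinuousOn y₁ (uIcc 0 3) :=
    hY.continuousOn.congr fun t ht => hYy t (by rwa [uIcc_of_le (by norm_num)] at ht)
  have hintegral : IntervalIntegrable (fun t => (y₁ t - yd t) ^ 2) volume 0 3 :=
    ((hy_cont.sub hyd_cont.continuousOn).pow 2).intervalIntegrable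
  have hcost : ∫ t in (0 : ℝ)..3, (ybar t - yd t) ^ 2 ≤ ∫ t in (0 : ℝ)..3, (y₁ t - yd t) ^ 2 := by
    rw [integral_of_le (by norm_num), integral_of_le (by norm_num)]
    refine integral_mono_of_nonneg (.of_forall fun t => sq_nonneg _) hintegral.1 ?_
    filter_upwards [ae_restrict_mem measurableSet_Ioc] with t ht
    exact sq_le_sq.2 (hpt t (Ioc_subset_Icc_self ht))
  have hend : ybar 3 = 1 := by
    rw [hyb, if_neg (by linarith), if_neg (by norm_num)]
    norm_num
  refine ⟨?_, ?_⟩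
  · filter_upwards [ae_restrict_mem measurableSet_Ioo] with t ht
    exact hpt t (Ioo_subset_Icc_self ht)
  · rw [hend]
    nlinarith [sq_nonneg (y₁ 3 - 1)]
end

section
/- Define on [0,3]: ū(t) = π² + 1 for t ∈ [0, log 2), ū(t) = π² for t ∈ [log 2, 2), ū(t) = π² − 1/(4 − t) for t ∈ [2, 3]; and ȳ₁(t) = e^t for t ∈ [0, log 2], ȳ₁(t) = 2 for t ∈ [log 2, 2], ȳ₁(t) = 4 − t for t ∈ [2, 3]. Let v(t) := −1 − ū(t) and let z₁ : [0,3] → ℝ be the absolutely continuous solution of z₁′(t) = (ū(t) − π²) z₁(t) + v(t) ȳ₁(t) a.e. on (0,3) with z₁(0) = 0. Then there exists ε > 0 such that ȳ₁(t) − 2 + z₁(t) < −ε for all t ∈ [0,3]. -/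
open MeasureTheory Set Real intervalIntegral

/-- On the part of `[0,3]` where `|z| ≤ 2`, a field `a z + v y` with `|a| ≤ 1`, `v ≤ -3` and
`1 ≤ y` is at most `-1/3`; hence a primitive `z` of such a field with `z 0 = 0` stays below the
line `-t/3`. -/
theorem le_neg_div_three_of_linear_ode {a v y z z' : ℝ → ℝ}
    (ha : ∀ t ∈ Ioo (0 : ℝ) 3, |a t| ≤ 1) (hv : ∀ t ∈ Ioo (0 : ℝ) 3, v t ≤ -3)
    (hy : ∀ t ∈ Ioo (0 : ℝ) 3, 1 ≤ y t) (hz0 : z 0 = 0)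
    (hz'_int : IntegrableOn z' (Icc 0 3))
    (hAC : ∀ t ∈ Icc (0 : ℝ) 3, z t = z 0 + ∫ s in (0 : ℝ)..t, z' s)
    (hODE : ∀ᵐ t ∂(volume.restrict (Ioo 0 3)), z' t = a t * z t + v t * y t) :
    ∀ t ∈ Icc (0 : ℝ) 3, z t ≤ -t / 3 := by
  have hz : ContinuousOn z (Icc 0 3) := by
    rw [← uIcc_of_le (by norm_num : (0 : ℝ) ≤ 3)] at hz'_int hAC ⊢
    exact (continuousOn_const.add (continuousOn_primitive_interval hz'_int)).congr hAC
  have hint : ∀ x ∈ Icc (0 : ℝ) 3, ∀ w ∈ Icc (0 : ℝ) 3, IntervalIntegrable z' volume x w :=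
    fun x hx w hw => (hz'_int.mono_set (uIcc_subset_Icc hx hw)).intervalIntegrable
  have hclosed : IsClosed ({t | z t ≤ -t / 3} ∩ Icc 0 3) := by
    have := isClosed_Icc.isClosed_le hz
      (by fun_prop : ContinuousOn (fun t : ℝ => -t / 3) (Icc 0 3))
    convert this using 1
    ext t
    simp [and_comm]
  refine hclosed.Icc_subset_of_forall_mem_nhdsWithin (by simp [hz0]) ?_
  rintro x ⟨hx, hx0, hx3⟩
  rw [mem_ofPred_eq] at hx
  have hxI : x ∈ Icc (0 : ℝ) 3 := ⟨hx0, hx3.le⟩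
  have hzx : Filter.Tendsto z (nhdsWithin x (Ioi x)) (nhds (z x)) :=
    ((hz x hxI).mono_of_mem_nhdsWithin
      (Filter.mem_of_superset (Icc_mem_nhdsGT hx3) (Icc_subset_Icc_left hx0))).tendsto
  rcases hx.lt_or_eq with hlt | heq
  · have hline : Filter.Tendsto (fun t : ℝ => -t / 3) (nhdsWithin x (Ioi x)) (nhds (-x / 3)) :=
      (by fun_prop : Continuous fun t : ℝ => -t / 3).continuousWithinAt.tendsto
    exact (hzx.eventually_lt hline hlt).mono fun t ht => le_of_lt ht
  · have hbd : ∀ᶠ t in nhdsWithin x (Ioi x), z t ∈ Ioo (-2 : ℝ) 2 :=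
      hzx.eventually (Ioo_mem_nhds (by linarith) (by linarith))
    obtain ⟨u, hu, hsub⟩ := (mem_nhdsGT_iff_exists_Ioo_subset).1 hbd
    have hxu : x < min u 3 := lt_min hu hx3
    filter_upwards [Ioo_mem_nhdsGT hxu] with w hw
    have hwu : w < u := hw.2.trans_le (min_le_left _ _)
    have hw3 : w < 3 := hw.2.trans_le (min_le_right _ _)
    have hwI : w ∈ Icc (0 : ℝ) 3 := ⟨hx0.trans hw.1.le, hw3.le⟩
    have h0 : (0 : ℝ) ∈ Icc (0 : ℝ) 3 := by norm_num
    have hle : ∫ s in x..w, z' s ≤ ∫ _ in x..w, (-1 / 3 : ℝ) := by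
      rw [integral_of_le hw.1.le, integral_of_le hw.1.le, integral_Ioc_eq_integral_Ioo,
        integral_Ioc_eq_integral_Ioo]
      have hsub3 : Ioo x w ⊆ Ioo 0 3 := Ioo_subset_Ioo hx0 hw3.le
      refine setIntegral_mono_ae_restrict
        (hz'_int.mono_set (hsub3.trans Ioo_subset_Icc_self)) (by simp) ?_
      filter_upwards [ae_restrict_of_ae_restrict_of_subset hsub3 hODE,
        ae_restrict_mem measurableSet_Ioo] with s hs hsm
      have hs3 := hsub3 hsm
      have hzs : z s ∈ Ioo (-2 : ℝ) 2 := hsub ⟨hsm.1, hsm.2.trans hwu⟩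
      have h1 : a s * z s ≤ 1 * 2 := by
        refine (le_abs_self _).trans ?_
        rw [abs_mul]
        exact mul_le_mul (ha s hs3) (abs_le.2 ⟨hzs.1.le, hzs.2.le⟩) (abs_nonneg _) zero_le_one
      rw [hs]
      nlinarith [hv s hs3, hy s hs3]
    have hadd := integral_add_adjacent_intervals (hint 0 h0 x hxI) (hint x hxI w hwI)
    rw [intervalIntegral.integral_const, smul_eq_mul] at hle
    linarith [hAC x hxI, hAC w hwI]

/-- Verification (B.8) of the constraint qualification for the example of the paper's
appendix: with `v = −1 − ū` and `z₁` the solution of the linearized equation (B.7), there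
is `ε > 0` with `ȳ₁(t) − 2 + z₁(t) < −ε` on `[0,3]`. -/
theorem stmt_11 (ubar ybar v : ℝ → ℝ)
    (hub : ∀ t : ℝ, ubar t =
      if t < Real.log 2 then π ^ 2 + 1 else if t < 2 then π ^ 2 else π ^ 2 - 1 / (4 - t))
    (hyb : ∀ t : ℝ, ybar t =
      if t ≤ Real.log 2 then Real.exp t else if t ≤ 2 then 2 else 4 - t)
    (hv : ∀ t : ℝ, v t = -1 - ubar t)
    (z₁ z₁' : ℝ → ℝ) (hz0 : z₁ 0 = 0)
    (hz'_int : IntegrableOn z₁' (Icc 0 3))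
    (hAC : ∀ t ∈ Icc (0 : ℝ) 3, z₁ t = z₁ 0 + ∫ s in (0 : ℝ)..t, z₁' s)
    (hODE : ∀ᵐ t ∂(volume.restrict (Ioo 0 3)),
      z₁' t = (ubar t - π ^ 2) * z₁ t + v t * ybar t) :
    ∃ ε > 0, ∀ t ∈ Icc (0 : ℝ) 3, ybar t - 2 + z₁ t < -ε := by
  have hlog : 0.69 < Real.log 2 := by linarith [Real.log_two_gt_d9]
  have hlog' : Real.log 2 < 0.7 := by linarith [Real.log_two_lt_d9]
  have hpi : 9 < π ^ 2 := by nlinarith [Real.pi_gt_three]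
  have hfrac : ∀ t ∈ Ioo (0 : ℝ) 3, 0 < 1 / (4 - t) ∧ 1 / (4 - t) ≤ 1 := fun t ht =>
    ⟨one_div_pos.2 (by linarith [ht.2]), (div_le_one (by linarith [ht.2])).2 (by linarith [ht.2])⟩
  have hz : ∀ t ∈ Icc (0 : ℝ) 3, z₁ t ≤ -t / 3 := by
    refine le_neg_div_three_of_linear_ode (a := fun t => ubar t - π ^ 2) (fun t ht => ?_)
      (fun t ht => ?_) (fun t ht => ?_) hz0 hz'_int hAC hODE
    · have := hfrac t ht
      rw [hub, abs_le]
      split_ifs <;> constructor <;> linarith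
    · have := hfrac t ht
      rw [hv, hub]
      split_ifs <;> linarith
    · rw [hyb]
      split_ifs
      · exact Real.one_le_exp ht.1.le
      · norm_num
      · linarith [ht.2]
  refine ⟨1 / 100, by norm_num, fun t ht => ?_⟩
  have hzt := hz t ht
  rcases le_or_gt t (1 / 10) with h | h
  · have hexp : Real.exp t ≤ 10 / 9 := by
      have h1 := Real.one_sub_le_exp_neg t
      rw [Real.exp_neg] at h1
      have h2 : Real.exp t * (Real.exp t)⁻¹ = 1 := mul_inv_cancel₀ (Real.exp_pos t).ne'
      nlinarith [Real.exp_pos t]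
    rw [hyb, if_pos (by linarith)]
    linarith [ht.1]
  · have hy2 : ybar t ≤ 2 := by
      rw [hyb]
      split_ifs with h1 h2
      · exact (Real.le_log_iff_exp_le two_pos).1 h1
      · exact le_rfl
      · linarith
    linarith
end
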